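/- Let ε ∈ (0, 1/2), let β > 0, let G = (L ∪ R, E) be a finite bipartite simple graph with parts L and R, let H ⊆ E be an EDBS of G with parameter β (deg_H(e) ≤ β for every e ∈ H), and let U = {e ∈ E ∖ H : deg_H(e) < (1−ε)·β} be the set of underfull edges. Then either μ(H) ≥ ε·μ(G) or μ(H ∪ U) ≥ (1 − 5ε)·μ(G). -/

import Mathlib

open Finset
open scoped Classical

/-- The degree of a vertex `v` in an edge set `H`: the number of edges of `H` incident to `v`. -/
noncomputable def degV {V : Type*} (H : Finset (Sym2 V)) (v : V) : ℕ :=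
  (H.filter (fun e => v ∈ e)).card

/-- The edge degree of an unordered pair `e = {u,w}` in an edge set `H`:
`deg_H(u) + deg_H(w)`. -/
noncomputable def degE {V : Type*} (H : Finset (Sym2 V)) (e : Sym2 V) : ℕ :=
  Sym2.lift ⟨fun u w => degV H u + degV H w, fun _ _ => add_comm _ _⟩ e

/-- `M` is a matching: its edges are non-loops and pairwise vertex-disjoint. -/
def IsMatching {V : Type*} (M : Finset (Sym2 V)) : Prop :=
  (∀ e ∈ M, ¬ e.IsDiag) ∧ ∀ e ∈ M, ∀ f ∈ M, e ≠ f → ∀ v : V, v ∈ e → v ∉ f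

/-- `matchNum F` = μ(F), the maximum size of a matching contained in the edge set `F`. -/
noncomputable def matchNum {V : Type*} (F : Finset (Sym2 V)) : ℕ :=
  F.powerset.sup (fun M => if IsMatching M then M.card else 0)

theorem IsMatching.subset {V : Type*} {M N : Finset (Sym2 V)} (hM : IsMatching M) (h : N ⊆ M) :
    IsMatching N :=
  ⟨fun e he => hM.1 e (h he), fun e he f hf => hM.2 e (h he) f (h hf)⟩

theorem IsMatching.card_le_matchNum {V : Type*} {M F : Finset (Sym2 V)} (hM : IsMatching M)
    (h : M ⊆ F) : M.card ≤ matchNum F := by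
  have := Finset.le_sup (f := fun M => if IsMatching M then M.card else 0)
    (Finset.mem_powerset.2 h)
  rwa [if_pos hM] at this

theorem isMatching_empty {V : Type*} : IsMatching (∅ : Finset (Sym2 V)) := by
  simp [IsMatching]

theorem exists_isMatching_card_eq_matchNum {V : Type*} (F : Finset (Sym2 V)) :
    ∃ M ⊆ F, IsMatching M ∧ M.card = matchNum F := by
  obtain ⟨M, hM, h⟩ := Finset.exists_mem_eq_sup F.powerset ⟨∅, by simp⟩
    (fun M => if IsMatching M then M.card else 0)
  by_cases hm : IsMatching M
  · exact ⟨M, Finset.mem_powerset.1 hM, hm, by simpa [matchNum, hm] using h.symm⟩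
  · refine ⟨∅, by simp, isMatching_empty, ?_⟩
    simpa [matchNum, hm] using h.symm

/-- The set of vertices covered by an edge set. -/
noncomputable def coveredVertices {V : Type*} (M : Finset (Sym2 V)) : Finset V :=
  M.biUnion Sym2.toFinset

theorem mem_coveredVertices {V : Type*} {M : Finset (Sym2 V)} {v : V} :
    v ∈ coveredVertices M ↔ ∃ e ∈ M, v ∈ e := by
  simp [coveredVertices]

theorem IsMatching.sum_card_inter {V : Type*} {M : Finset (Sym2 V)} (hM : IsMatching M)
    (S : Finset V) :
    ∑ e ∈ M, (e.toFinset ∩ S).card = (coveredVertices M ∩ S).card := by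
  rw [coveredVertices, Finset.biUnion_inter, Finset.card_biUnion]
  intro e he f hf hef
  refine Finset.disjoint_left.2 fun v hv hv' => ?_
  simp only [Finset.mem_inter, Sym2.mem_toFinset] at hv hv'
  exact hM.2 e he f hf hef v hv.1 hv'.1

theorem card_coveredVertices_le {V : Type*} (M : Finset (Sym2 V)) :
    (coveredVertices M).card ≤ M.card * 2 := by
  refine Finset.card_biUnion_le_card_mul _ _ _ fun e _ => ?_
  rw [Sym2.card_toFinset]
  split_ifs <;> simp

theorem degE_eq_sum_card_inter {V : Type*} (H : Finset (Sym2 V)) {e : Sym2 V} (he : ¬ e.IsDiag) :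
    degE H e = ∑ h ∈ H, (e.toFinset ∩ h.toFinset).card := by
  induction e with
  | _ u w =>
    have huw : u ≠ w := by simpa using he
    simp only [degE, Sym2.lift_mk, degV, Finset.card_filter]
    rw [← Finset.sum_add_distrib]
    refine Finset.sum_congr rfl fun h _ => ?_
    rw [← Finset.filter_mem_eq_inter, Finset.card_filter, Sym2.toFinset_mk_eq,
      Finset.sum_pair huw]
    simp

theorem IsMatching.sum_degE {V : Type*} {M : Finset (Sym2 V)} (hM : IsMatching M)
    (H : Finset (Sym2 V)) :
    ∑ e ∈ M, degE H e = ∑ h ∈ H, (coveredVertices M ∩ h.toFinset).card := by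
  rw [Finset.sum_congr rfl fun e he => degE_eq_sum_card_inter H (hM.1 e he), Finset.sum_comm]
  exact Finset.sum_congr rfl fun h _ => hM.sum_card_inter _

/-- A matching of maximum size in `F` meets every non-loop edge of `F`. -/
theorem IsMatching.inter_nonempty_of_card_eq {V : Type*} {N F : Finset (Sym2 V)}
    (hN : IsMatching N) (hNF : N ⊆ F) (hcard : N.card = matchNum F) {h : Sym2 V} (hh : h ∈ F)
    (hd : ¬ h.IsDiag) : (coveredVertices N ∩ h.toFinset).Nonempty := by
  by_contra hne
  have hdisj : ∀ v ∈ h, ∀ e ∈ N, v ∉ e := by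
    intro v hv e he hve
    exact hne ⟨v, by simpa [mem_coveredVertices] using ⟨⟨e, he, hve⟩, hv⟩⟩
  have hnot : h ∉ N := by
    intro hmem
    induction h with
    | _ u w => exact hdisj u (by simp) _ hmem (by simp)
  have hins : IsMatching (insert h N) := by
    refine ⟨?_, ?_⟩
    · intro e he
      rcases Finset.mem_insert.1 he with rfl | he
      exacts [hd, hN.1 e he]
    · intro e he f hf hef v hve hvf
      rcases Finset.mem_insert.1 he with he' | he' <;>
        rcases Finset.mem_insert.1 hf with hf' | hf'
      · exact hef (he'.trans hf'.symm)
      · exact hdisj v (he' ▸ hve) f hf' hvf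
      · exact hdisj v (hf' ▸ hvf) e he' hve
      · exact hN.2 e he' f hf' hef v hve hvf
  have := hins.card_le_matchNum (Finset.insert_subset hh hNF)
  rw [Finset.card_insert_of_notMem hnot] at this
  omega

/-- If the matching `N` meets every edge of `H`, then a matching `K` avoiding the vertices of `N`
has total edge degree at most that of `N`. -/
theorem IsMatching.sum_degE_le_sum_degE {V : Type*} {K N H : Finset (Sym2 V)}
    (hK : IsMatching K) (hN : IsMatching N)
    (hdisj : Disjoint (coveredVertices K) (coveredVertices N))
    (hmeet : ∀ h ∈ H, (coveredVertices N ∩ h.toFinset).Nonempty) :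
    ∑ e ∈ K, degE H e ≤ ∑ e ∈ N, degE H e := by
  rw [hK.sum_degE, hN.sum_degE]
  refine Finset.sum_le_sum fun h hh => ?_
  have hpos := (hmeet h hh).card_pos
  have htwo : h.toFinset.card ≤ 2 := by
    rw [Sym2.card_toFinset]
    split_ifs <;> simp
  have hsum : (coveredVertices K ∩ h.toFinset).card + (coveredVertices N ∩ h.toFinset).card
      ≤ h.toFinset.card := by
    rw [← Finset.card_union_of_disjoint
      (hdisj.mono Finset.inter_subset_left Finset.inter_subset_left)]
    exact Finset.card_le_card (Finset.union_subset Finset.inter_subset_right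
      Finset.inter_subset_right)
  omega

/-- At most `#S` edges of a matching touch the vertex set `S`. -/
theorem IsMatching.card_filter_inter_nonempty_le {V : Type*} {M : Finset (Sym2 V)}
    (hM : IsMatching M) (S : Finset V) :
    (M.filter fun e => (e.toFinset ∩ S).Nonempty).card ≤ S.card := by
  calc (M.filter fun e => (e.toFinset ∩ S).Nonempty).card
      ≤ ∑ e ∈ M, (e.toFinset ∩ S).card := by
        rw [Finset.card_filter]
        refine Finset.sum_le_sum fun e _ => ?_
        split_ifs with h
        · exact h.card_pos
        · exact Nat.zero_le _
    _ = (coveredVertices M ∩ S).card := hM.sum_card_inter S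
    _ ≤ S.card := Finset.card_le_card Finset.inter_subset_right

/-- bipartite dichotomy — either μ(H) ≥ ε·μ(G) or μ(H ∪ U) ≥ (1−5ε)·μ(G). -/
theorem bipartite_dichotomy (V : Type) (ε β : ℝ) (hε : ε ∈ Set.Ioo (0 : ℝ) (1/2))
    (hβ : 0 < β) (L R : Finset V) (hLR : Disjoint L R)
    (E : Finset (Sym2 V)) (hbip : ∀ e ∈ E, ∃ u ∈ L, ∃ w ∈ R, e = s(u, w))
    (H : Finset (Sym2 V)) (hHE : H ⊆ E)
    (hEDBS : ∀ e ∈ H, (degE H e : ℝ) ≤ β)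
    (U : Finset (Sym2 V))
    (hU : U = E.filter (fun e => e ∉ H ∧ (degE H e : ℝ) < (1 - ε) * β)) :
    ε * matchNum E ≤ (matchNum H : ℝ) ∨ (1 - 5 * ε) * matchNum E ≤ (matchNum (H ∪ U) : ℝ) := by
  obtain ⟨hε0, hε1⟩ := hε
  have hloop : ∀ e ∈ E, ¬ e.IsDiag := by
    intro e he
    obtain ⟨u, hu, w, hw, rfl⟩ := hbip e he
    simpa using fun h : u = w => Finset.disjoint_left.1 hLR hu (h ▸ hw)
  obtain ⟨M, hME, hM, hMcard⟩ := exists_isMatching_card_eq_matchNum E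
  obtain ⟨N, hNH, hN, hNcard⟩ := exists_isMatching_card_eq_matchNum H
  rw [or_iff_not_imp_left, not_le]
  intro hsmall
  set C := coveredVertices N
  set T := M.filter fun e => (e.toFinset ∩ C).Nonempty
  set A := M.filter fun e => ¬ (e.toFinset ∩ C).Nonempty
  set K := A.filter fun e => e ∉ H ∪ U
  set J := A.filter fun e => e ∈ H ∪ U
  have hAM : A ⊆ M := Finset.filter_subset _ _
  have hKA : K ⊆ A := Finset.filter_subset _ _
  have hTA : T.card + A.card = M.card := Finset.card_filter_add_card_filter_not _
  have hJK : J.card + K.card = A.card := Finset.card_filter_add_card_filter_not _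
  have hT : T.card ≤ N.card * 2 :=
    (hM.card_filter_inter_nonempty_le C).trans (card_coveredVertices_le N)
  have hJle : J.card ≤ matchNum (H ∪ U) :=
    (hM.subset ((Finset.filter_subset _ _).trans hAM)).card_le_matchNum
      fun e he => (Finset.mem_filter.1 he).2
  have hdisj : Disjoint (coveredVertices K) C := by
    rw [Finset.disjoint_left]
    intro v hv hvC
    obtain ⟨e, he, hve⟩ := mem_coveredVertices.1 hv
    exact (Finset.mem_filter.1 (hKA he)).2 ⟨v, by simpa using ⟨hve, hvC⟩⟩
  have hdeg : ∑ e ∈ K, degE H e ≤ ∑ e ∈ N, degE H e :=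
    (hM.subset (hKA.trans hAM)).sum_degE_le_sum_degE hN hdisj fun h hh =>
      hN.inter_nonempty_of_card_eq hNH hNcard hh (hloop h (hHE hh))
  have hlow : (K.card : ℝ) * ((1 - ε) * β) ≤ ∑ e ∈ K, (degE H e : ℝ) := by
    rw [← nsmul_eq_mul]
    refine Finset.card_nsmul_le_sum _ _ _ fun e he => ?_
    have heE := hME (hAM (hKA he))
    have hnot := (Finset.mem_filter.1 he).2
    rw [Finset.mem_union, hU, Finset.mem_filter] at hnot
    by_contra! hlt
    exact hnot (by tauto)
  have hupp : ∑ e ∈ N, (degE H e : ℝ) ≤ N.card * β := by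
    rw [← nsmul_eq_mul]
    exact Finset.sum_le_card_nsmul _ _ _ fun e he => hEDBS e (hNH he)
  have hmid : ∑ e ∈ K, (degE H e : ℝ) ≤ ∑ e ∈ N, (degE H e : ℝ) := by exact_mod_cast hdeg
  have hKN : (K.card : ℝ) * (1 - ε) ≤ N.card := by
    refine le_of_mul_le_mul_right ?_ hβ
    linarith
  have hK2 : (K.card : ℝ) ≤ 2 * N.card := by
    nlinarith [(Nat.cast_nonneg K.card : (0 : ℝ) ≤ K.card)]
  have hTA' : (T.card : ℝ) + A.card = M.card := by exact_mod_cast hTA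
  have hJK' : (J.card : ℝ) + K.card = A.card := by exact_mod_cast hJK
  have hT' : (T.card : ℝ) ≤ N.card * 2 := by exact_mod_cast hT
  have hJle' : (J.card : ℝ) ≤ matchNum (H ∪ U) := by exact_mod_cast hJle
  rw [← hNcard, ← hMcard] at hsmall
  rw [← hMcard]
  nlinarith [(Nat.cast_nonneg N.card : (0 : ℝ) ≤ N.card)]
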